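/- For every integer n ≥ 4, every multiset of exactly 12n − 16 colored cubes admits an n-frame solution using all of its cubes. Consequently, for n ≥ 4 the least number of colored cubes guaranteeing that an n-frame can be built equals 12n − 16, the number of cubes in the frame. -/

import Mathlib

open scoped Classical

/-- A colored cube: a bijection assigning to each face (`Fin 6`) a color (`Fin 6`). -/
abbrev CCube := Equiv.Perm (Fin 6)

/-- The opposite-face involution: face `i` is opposite face `i + 3`. -/
def tau (i : Fin 6) : Fin 6 := i + 3

/-- Quarter-turn rotation about the axis through the face pair `{2, 5}`. -/
def r1 : Equiv.Perm (Fin 6) := ([0, 1, 3, 4] : List (Fin 6)).formPerm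

/-- Quarter-turn rotation about the axis through the face pair `{0, 3}`. -/
def r2 : Equiv.Perm (Fin 6) := ([1, 2, 4, 5] : List (Fin 6)).formPerm

/-- The rotation group of the cube, acting on the set of faces. -/
def G : Subgroup (Equiv.Perm (Fin 6)) := Subgroup.closure {r1, r2}

/-- Two colored cubes have the same variety iff one is obtained from the other by
precomposition with a rotation. -/
def sameVariety (c d : CCube) : Prop := ∃ g ∈ G, d = c * g

def varietySetoid : Setoid CCube where
  r := sameVariety
  iseqv := by
    refine ⟨fun c => ⟨1, G.one_mem, (mul_one c).symm⟩, ?_, ?_⟩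
    · rintro c d ⟨g, hg, rfl⟩
      exact ⟨g⁻¹, G.inv_mem hg, by group⟩
    · rintro a b c ⟨g, hg, rfl⟩ ⟨h, hh, rfl⟩
      exact ⟨g * h, G.mul_mem hg hh, by group⟩

/-- A variety is a `G`-orbit of colored cubes. -/
def Variety := Quotient varietySetoid

/-- The variety of a colored cube. -/
def varietyOf (c : CCube) : Variety := Quotient.mk varietySetoid c

/-- The three opposite pairs of colors of a colored cube. -/
def oppPairs (c : CCube) : Finset (Finset (Fin 6)) :=
  Finset.image (fun i => ({c i, c (tau i)} : Finset (Fin 6))) Finset.univ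

/-- The twelve adjacent pairs of colors of a colored cube. -/
def adjPairs (c : CCube) : Finset (Finset (Fin 6)) :=
  Finset.image (fun p : Fin 6 × Fin 6 => ({c p.1, c p.2} : Finset (Fin 6)))
    (Finset.univ.filter (fun p : Fin 6 × Fin 6 => p.2 ≠ p.1 ∧ p.2 ≠ tau p.1))

/-- The mirror cube of `c`. -/
def mirror (c : CCube) : CCube := c * Equiv.swap 0 3

/-- Cyclic rotation of an ordered triple. -/
def cyc (t : Fin 6 × Fin 6 × Fin 6) : Fin 6 × Fin 6 × Fin 6 := (t.2.1, t.2.2, t.1)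

/-- The cyclic equivalence class of an ordered triple. -/
def cycClass (t : Fin 6 × Fin 6 × Fin 6) : Finset (Fin 6 × Fin 6 × Fin 6) :=
  {t, cyc t, cyc (cyc t)}

/-- The eight corner triples of a colored cube: faces `0, 1, 2` meet at a corner, read
clockwise, and the corners of the cube are the images of this corner under rotations. -/
noncomputable def cornerTriples (c : CCube) : Finset (Finset (Fin 6 × Fin 6 × Fin 6)) :=
  Finset.univ.filter (fun s => ∃ g ∈ G, s = cycClass (c (g 0), c (g 1), c (g 2)))

/-- The opposite pairs of a variety. -/
noncomputable def vOpp (v : Variety) : Finset (Finset (Fin 6)) := oppPairs (Quotient.out v)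

/-- The adjacent pairs of a variety. -/
noncomputable def vAdj (v : Variety) : Finset (Finset (Fin 6)) := adjPairs (Quotient.out v)

/-- The corner triples of a variety. -/
noncomputable def vCorners (v : Variety) : Finset (Finset (Fin 6 × Fin 6 × Fin 6)) :=
  cornerTriples (Quotient.out v)

/-- The mirror variety of a variety. -/
noncomputable def vMirror (v : Variety) : Variety := varietyOf (mirror (Quotient.out v))

/-- A pentad: five varieties which pairwise share no corner triples and whose fifteen
opposite pairs comprise each unordered pair of colors exactly once. -/
def IsPentad (P : Finset Variety) : Prop :=
  P.card = 5 ∧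
  (∀ v ∈ P, ∀ w ∈ P, v ≠ w → vCorners v ∩ vCorners w = ∅) ∧
  (∀ p : Finset (Fin 6), p.card = 2 → ∃! v, v ∈ P ∧ p ∈ vOpp v)

/-- A corner solution from the multiset `S` modeled on the cube `m`: eight distinct cube
instances from `S` in bijection with the eight corner triples of `m`, each chosen cube having
its assigned corner triple among its own corner triples. -/
def CornerSolutionOn (S : Multiset CCube) (m : CCube) : Prop :=
  ∃ ψ : Finset (Fin 6 × Fin 6 × Fin 6) → CCube,
    Multiset.map ψ (cornerTriples m).val ≤ S ∧
    ∀ t ∈ cornerTriples m, t ∈ cornerTriples (ψ t)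

/-- `S` contains a corner solution modeled on some variety. -/
def HasCornerSolution (S : Multiset CCube) : Prop := ∃ m : CCube, CornerSolutionOn S m

/-- An `n`-frame solution from `S` modeled on the cube `m`: a corner solution together with,
for each of the twelve adjacent pairs of `m`, a further `n - 2` cube instances having that
adjacent pair, all `12n - 16` cube instances distinct. -/
def FrameSolutionOn (n : ℕ) (S : Multiset CCube) (m : CCube) : Prop :=
  ∃ (ψ : Finset (Fin 6 × Fin 6 × Fin 6) → CCube) (f : Finset (Fin 6) → Multiset CCube),
    (∀ t ∈ cornerTriples m, t ∈ cornerTriples (ψ t)) ∧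
    (∀ p ∈ adjPairs m, Multiset.card (f p) = n - 2 ∧ ∀ x ∈ f p, p ∈ adjPairs x) ∧
    Multiset.map ψ (cornerTriples m).val + (adjPairs m).sum f ≤ S

/-- `S` contains an `n`-frame solution modeled on some variety. -/
def HasFrameSolution (n : ℕ) (S : Multiset CCube) : Prop := ∃ m : CCube, FrameSolutionOn n S m

section Counting

variable {V α : Type*} [DecidableEq α] {K : V → Finset α} {x : V → ℕ}

/-- Counting incidences of `T` with sets which meet `T` in at most two points. -/
lemma sum_load_le {A : Finset V} {T : Finset α} (h : ∀ u ∈ A, (K u ∩ T).card ≤ 2) :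
    ∑ s ∈ T, ∑ u ∈ A with s ∈ K u, x u ≤ 2 * ∑ u ∈ A with ¬Disjoint (K u) T, x u := by
  have key : ∑ s ∈ T, ∑ u ∈ A with s ∈ K u, x u = ∑ u ∈ A, (K u ∩ T).card * x u := by
    simp_rw [Finset.sum_filter]
    rw [Finset.sum_comm]
    refine Finset.sum_congr rfl fun u _ => ?_
    rw [← Finset.sum_filter, Finset.sum_const, smul_eq_mul, Finset.filter_mem_eq_inter,
      Finset.inter_comm]
  rw [key, Finset.mul_sum, Finset.sum_filter]
  refine Finset.sum_le_sum fun u hu => ?_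
  split_ifs with hd
  · rw [Finset.disjoint_iff_inter_eq_empty] at hd
    simp [hd]
  · exact Nat.mul_le_mul_right _ (h u hu)

/-- A set of points covered by a family, each member of which contains at most two of them. -/
lemma card_le_two_mul_card {I : Finset V} {T : Finset α} (hT : T ⊆ I.biUnion K)
    (h : ∀ u ∈ I, (K u ∩ T).card ≤ 2) :
    T.card ≤ 2 * (I.filter fun u => ¬Disjoint (K u) T).card := by
  have h1 : T ⊆ (I.filter fun u => ¬Disjoint (K u) T).biUnion fun u => K u ∩ T := by
    intro s hs
    obtain ⟨u, hu, hsu⟩ := Finset.mem_biUnion.1 (hT hs)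
    exact Finset.mem_biUnion.2 ⟨u, Finset.mem_filter.2
      ⟨hu, Finset.not_disjoint_iff.2 ⟨s, hsu, hs⟩⟩, Finset.mem_inter.2 ⟨hsu, hs⟩⟩
  calc T.card ≤ _ := Finset.card_le_card h1
    _ ≤ _ := Finset.card_biUnion_le_card_mul _ _ 2 fun u hu => h u (Finset.mem_filter.1 hu).1
    _ = _ := Nat.mul_comm _ _

/-- Hall's condition for the points of `K v`. -/
def HallAt [Fintype V] (K : V → Finset α) (x : V → ℕ) (v : V) : Prop :=
  ∀ T ⊆ K v, T.card ≤ ∑ u with ¬Disjoint (K u) T, x u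

lemma exists_deficient [Fintype V] {v : V} (hv : ¬HallAt K x v) :
    ∃ T ⊆ K v, ∑ u with ¬Disjoint (K u) T, x u < T.card := by
  simpa [HallAt] using hv

/-- Four pairwise disjoint sets of multiplicity at least two yield Hall's condition somewhere. -/
lemma card_le_three_of_pairwise_disjoint [Fintype V]
    (h2 : ∀ u v, u ≠ v → (K u ∩ K v).card ≤ 2)
    (h4 : ∀ I : Finset V, I.card = 4 → (∀ u ∈ I, ∀ w ∈ I, u ≠ w → Disjoint (K u) (K w)) →
      ∃ v ∉ I, K v ⊆ I.biUnion K)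
    (hfail : ∀ v, ¬HallAt K x v) {I : Finset V} (hI : ∀ u ∈ I, 2 ≤ x u)
    (hd : ∀ u ∈ I, ∀ w ∈ I, u ≠ w → Disjoint (K u) (K w)) : I.card ≤ 3 := by
  by_contra! hc
  obtain ⟨J, hJI, hJ⟩ := Finset.exists_subset_card_eq (show 4 ≤ I.card from hc)
  obtain ⟨v, hvJ, hv⟩ := h4 J hJ fun u hu w hw => hd u (hJI hu) w (hJI hw)
  refine hfail v fun T hT => ?_
  have h1 := card_le_two_mul_card (hT.trans hv) fun u hu =>
    (Finset.card_le_card (Finset.inter_subset_inter_left hT)).trans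
      (h2 u v fun h => hvJ (h ▸ hu))
  calc T.card ≤ _ := h1
    _ = ∑ u ∈ J with ¬Disjoint (K u) T, 2 := by rw [Finset.sum_const, smul_eq_mul, mul_comm]
    _ ≤ ∑ u ∈ J with ¬Disjoint (K u) T, x u :=
      Finset.sum_le_sum fun u hu => hI u (hJI (Finset.mem_filter.1 hu).1)
    _ ≤ _ := Finset.sum_le_sum_of_subset (Finset.filter_subset_filter _ (Finset.subset_univ _))

/-- Failure of Hall's condition at `v` bounds the multiplicity of `v`. -/
lemma lt_card_of_not_hallAt [Fintype V] {v : V} (hv : ¬HallAt K x v) : x v < (K v).card := by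
  obtain ⟨T, hT, hlt⟩ := exists_deficient hv
  obtain ⟨s₀, hs₀⟩ : T.Nonempty := Finset.card_pos.1 (by omega)
  have h1 : x v ≤ ∑ u with ¬Disjoint (K u) T, x u :=
    Finset.single_le_sum (f := x) (fun _ _ => Nat.zero_le _) (Finset.mem_filter.2
      ⟨Finset.mem_univ v, Finset.not_disjoint_iff.2 ⟨s₀, hT hs₀, hs₀⟩⟩)
  have := Finset.card_le_card hT
  omega

section FrameBound

variable [Fintype V] {β : Type*} [DecidableEq β] {O : V → Finset β} {Ω : Finset α} {D : Finset β}

/-- Hall's condition for the points of `K v`, together with `k` copies of each element of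
`D \ O v`. -/
def FrameHallAt (K : V → Finset α) (O : V → Finset β) (D : Finset β) (x : V → ℕ) (k : ℕ)
    (v : V) : Prop :=
  ∀ T ⊆ K v, ∀ E ⊆ D \ O v,
    T.card + k * E.card ≤ ∑ u with ¬Disjoint (K u) T ∨ ¬E ⊆ O u, x u

/-- A set of more than three elements of `D` is not contained in any `O u`. -/
lemma frame_bound_of_three_lt_card {k : ℕ} {v : V} {T : Finset α} {E : Finset β}
    (h8 : (K v).card = 8) (hO3 : ∀ v, (O v).card = 3) (hD : (D \ O v).card = 12)
    (hx : ∑ v, x v = 12 * k + 8) (hT : T ⊆ K v) (hE : E ⊆ D \ O v) (hE3 : 3 < E.card) :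
    T.card + k * E.card ≤ ∑ u with ¬Disjoint (K u) T ∨ ¬E ⊆ O u, x u := by
  rw [Finset.filter_true_of_mem, hx]
  · have h1 := Finset.card_le_card hT
    have h2 := Nat.mul_le_mul_left k (Finset.card_le_card hE)
    rw [hD] at h2
    omega
  · intro u _
    refine Or.inr fun h => ?_
    have := Finset.card_le_card h
    have := hO3 u
    omega

/-- If no element of `D` lies in too many of the `O u`, then Hall's condition for the points of
`K v` suffices. -/
lemma frameHallAt_of_light {k : ℕ} {v : V} (h8 : (K v).card = 8) (hO3 : ∀ v, (O v).card = 3)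
    (hD : (D \ O v).card = 12) (hx : ∑ v, x v = 12 * k + 8)
    (hlight : ∀ e, ∑ u with e ∈ O u, x u ≤ 9 * k) (hv : HallAt K x v) :
    FrameHallAt K O D x k v := by
  intro T hT E hE
  rcases E.eq_empty_or_nonempty with rfl | ⟨e, he⟩
  · simpa using hv T hT
  rcases Nat.lt_or_ge 3 E.card with h3 | h3
  · exact frame_bound_of_three_lt_card h8 hO3 hD hx hT hE h3
  have h1 := Finset.sum_filter_add_sum_filter_not Finset.univ (fun u => e ∈ O u) x
  have h2 : ∑ u with e ∉ O u, x u ≤ ∑ u with ¬Disjoint (K u) T ∨ ¬E ⊆ O u, x u :=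
    Finset.sum_le_sum_of_subset fun u hu => by
      simp only [Finset.mem_filter, Finset.mem_univ, true_and] at hu ⊢
      exact Or.inr fun h => hu (h he)
  have h4 := hlight e
  have h5 := Finset.card_le_card hT
  have h6 := Nat.mul_le_mul_left k h3
  omega

/-- If some `e` lies in many of the `O u`, then the full Hall condition holds at a member of
maximal multiplicity among those with `e ∈ O u`. -/
lemma frameHallAt_of_heavy {k : ℕ} (hk : 2 ≤ k) {e : β} {v : V} (hv : e ∈ O v)
    (hmax : ∀ u, e ∈ O u → x u ≤ x v) (h8 : (K v).card = 8) (hO3 : ∀ v, (O v).card = 3)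
    (hD : (D \ O v).card = 12) (hx : ∑ v, x v = 12 * k + 8)
    (hAA : ∀ e', e ≠ e' → (Finset.univ.filter fun u => e ∈ O u ∧ e' ∈ O u).card ≤ 2)
    (hO : ∀ u w e₁ e₂, e₁ ≠ e₂ → e₁ ∈ O u → e₂ ∈ O u → e₁ ∈ O w → e₂ ∈ O w → O u = O w)
    (hK : ∀ u, e ∈ O u → O u ≠ O v → 2 ≤ (K u ∩ K v).card)
    (hKK : ∀ u w, u ≠ w → e ∈ O u → O u = O w → O u ≠ O v → (K v \ (K u ∪ K w)).card ≤ 5)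
    (hheavy : 9 * k < ∑ u with e ∈ O u, x u) (hHall : HallAt K x v) :
    FrameHallAt K O D x k v := by
  intro T hT E hE
  rcases E.eq_empty_or_nonempty with rfl | ⟨e₀, he₀⟩
  · simpa using hHall T hT
  rcases Nat.lt_or_ge 3 E.card with h3 | h3
  · exact frame_bound_of_three_lt_card h8 hO3 hD hx hT hE h3
  have he₀v : e₀ ∉ O v := (Finset.mem_sdiff.1 (hE he₀)).2
  have hee₀ : e ≠ e₀ := fun h => he₀v (h ▸ hv)
  have hTv := Finset.card_le_card hT
  set A := Finset.univ.filter fun u => e ∈ O u with hA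
  set Q := A.filter fun u => ¬(¬Disjoint (K u) T ∨ ¬E ⊆ O u) with hQdef
  have hQ : ∀ {u}, u ∈ Q ↔ e ∈ O u ∧ Disjoint (K u) T ∧ E ⊆ O u := by
    intro u
    simp [hQdef, hA]
  have hQ2 : Q.card ≤ 2 := by
    refine (Finset.card_le_card fun u hu => ?_).trans (hAA e₀ hee₀)
    obtain ⟨h1, -, h4⟩ := hQ.1 hu
    simp [h1, h4 he₀]
  have hQx : ∑ u ∈ Q, x u ≤ Q.card * x v :=
    Finset.sum_le_card_nsmul _ x _ fun u hu => hmax u (hQ.1 hu).1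
  have h1 := Finset.sum_filter_add_sum_filter_not A (fun u => ¬Disjoint (K u) T ∨ ¬E ⊆ O u) x
  rw [← hQdef] at h1
  have h4 : ∑ u ∈ A with ¬Disjoint (K u) T ∨ ¬E ⊆ O u, x u
      ≤ ∑ u with ¬Disjoint (K u) T ∨ ¬E ⊆ O u, x u :=
    Finset.sum_le_sum_of_subset (Finset.filter_subset_filter _ (Finset.subset_univ _))
  have h5 : x v ≤ ∑ u with ¬Disjoint (K u) T ∨ ¬E ⊆ O u, x u :=
    Finset.single_le_sum (f := x) (fun _ _ => Nat.zero_le _)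
      (Finset.mem_filter.2 ⟨Finset.mem_univ v, Or.inr fun h => he₀v (h he₀)⟩)
  rcases Q.eq_empty_or_nonempty with hQ0 | ⟨u, hu⟩
  · rw [hQ0, Finset.sum_empty] at h1
    have := Nat.mul_le_mul_left k h3
    omega
  obtain ⟨heu, hdu, hEu⟩ := hQ.1 hu
  have heE : e ∉ E := fun h => (Finset.mem_sdiff.1 (hE h)).2 hv
  have hE2 : E.card ≤ 2 := by
    have := Finset.card_le_card (Finset.insert_subset heu hEu)
    rw [Finset.card_insert_of_notMem heE, hO3] at this
    omega
  have hE1 : 1 ≤ E.card := Finset.card_pos.2 ⟨e₀, he₀⟩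
  have hOuv : O u ≠ O v := fun h => he₀v (h ▸ hEu he₀)
  have hT6 : T.card ≤ 6 := by
    have h6 : T ⊆ K v \ (K u ∩ K v) := fun s hs => Finset.mem_sdiff.2
      ⟨hT hs, fun h => Finset.disjoint_left.1 hdu (Finset.mem_inter.1 h).1 hs⟩
    have h7 := Finset.card_le_card h6
    rw [Finset.card_sdiff_of_subset Finset.inter_subset_right] at h7
    have := hK u heu hOuv
    omega
  have hQ1 : 1 ≤ Q.card := Finset.card_pos.2 ⟨u, hu⟩
  obtain hQc | hQc : Q.card = 1 ∨ Q.card = 2 := by omega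
  · rw [hQc] at hQx
    have := Nat.mul_le_mul_left k hE2
    omega
  · have hT5 : T.card ≤ 5 := by
      obtain ⟨w, hw, hwu⟩ := Finset.exists_mem_ne (show 1 < Q.card by omega) u
      obtain ⟨hew, hdw, hEw⟩ := hQ.1 hw
      refine (Finset.card_le_card fun s hs => ?_).trans (hKK u w hwu.symm heu
        (hO u w e e₀ hee₀ heu (hEu he₀) hew (hEw he₀)) hOuv)
      simp only [Finset.mem_sdiff, Finset.mem_union]
      exact ⟨hT hs, fun h => h.elim (fun h => Finset.disjoint_left.1 hdu h hs)
        fun h => Finset.disjoint_left.1 hdw h hs⟩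
    rw [hQc] at hQx
    obtain hEc | hEc : E.card = 1 ∨ E.card = 2 := by omega
    · rw [hEc]
      omega
    · have h6 := Finset.sum_filter_add_sum_filter_not Finset.univ
        (fun u => ¬Disjoint (K u) T ∨ ¬E ⊆ O u) x
      have h7 : (Finset.univ.filter fun u => ¬(¬Disjoint (K u) T ∨ ¬E ⊆ O u)) = Q := by
        ext w
        rw [hQ]
        simp only [Finset.mem_filter, Finset.mem_univ, true_and, not_or, not_not]
        refine ⟨fun h => ⟨?_, h⟩, fun h => h.2⟩
        obtain ⟨e₁, e₂, h12, rfl⟩ := Finset.card_eq_two.1 hEc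
        simp only [Finset.insert_subset_iff, Finset.singleton_subset_iff] at h hEu
        exact hO u w e₁ e₂ h12 hEu.1 hEu.2 h.2.1 h.2.2 ▸ heu
      rw [h7, hx] at h6
      rw [hEc]
      omega

end FrameBound

variable [DecidableEq V]

/-- If the Hall condition fails at `v`, then the multiplicity of `v` is bounded through the loads
which the other sets put on the points of `K v`. -/
lemma two_mul_succ_le_of_deficient [Fintype V]
    (h2 : ∀ u v, u ≠ v → (K u ∩ K v).card ≤ 2) {v : V}
    (hv : ∃ T ⊆ K v, ∑ u with ¬Disjoint (K u) T, x u < T.card) :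
    2 * (x v + 1) ≤ ∑ s ∈ K v, (2 - ∑ u ∈ Finset.univ.erase v with s ∈ K u, x u) := by
  obtain ⟨T, hT, hlt⟩ := hv
  obtain ⟨s₀, hs₀⟩ : T.Nonempty := Finset.card_pos.1 (by omega)
  have h1 := sum_load_le (x := x) (K := K) (A := Finset.univ.erase v) (T := T) fun u hu =>
    (Finset.card_le_card (Finset.inter_subset_inter_left hT)).trans
      (h2 u v (Finset.ne_of_mem_erase hu))
  have h3 : x v + ∑ u ∈ Finset.univ.erase v with ¬Disjoint (K u) T, x u
      = ∑ u with ¬Disjoint (K u) T, x u := by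
    rw [Finset.filter_erase, Finset.add_sum_erase _ _ (Finset.mem_filter.2 ⟨Finset.mem_univ v,
      Finset.not_disjoint_iff.2 ⟨s₀, hT hs₀, hs₀⟩⟩)]
  have h4 : 2 * T.card ≤ ∑ s ∈ T, (2 - ∑ u ∈ Finset.univ.erase v with s ∈ K u, x u)
      + ∑ s ∈ T, ∑ u ∈ Finset.univ.erase v with s ∈ K u, x u := by
    rw [← Finset.sum_add_distrib, mul_comm, ← smul_eq_mul, ← Finset.sum_const]
    exact Finset.sum_le_sum fun s _ => by omega
  have h5 : ∑ s ∈ T, (2 - ∑ u ∈ Finset.univ.erase v with s ∈ K u, x u)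
      ≤ ∑ s ∈ K v, (2 - ∑ u ∈ Finset.univ.erase v with s ∈ K u, x u) :=
    Finset.sum_le_sum_of_subset hT
  omega

/-- The total residual capacity at a point is at most two. -/
lemma sum_residual_le_two {P : Finset V} (hP : ∀ u ∈ P, x u ≠ 0) :
    ∑ v ∈ P, (2 - ∑ u ∈ P.erase v, x u) ≤ 2 := by
  have h1 : ∀ v ∈ P, 2 - ∑ u ∈ P.erase v, x u ≤ 3 - P.card := by
    intro v hv
    have h2 : (P.erase v).card ≤ ∑ u ∈ P.erase v, x u := by
      rw [Finset.card_eq_sum_ones]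
      exact Finset.sum_le_sum fun u hu => Nat.one_le_iff_ne_zero.2 (hP u (Finset.mem_of_mem_erase hu))
    rw [Finset.card_erase_of_mem hv] at h2
    have := Finset.card_pos.2 ⟨v, hv⟩
    omega
  have h2 := Finset.sum_le_card_nsmul P _ _ h1
  rw [smul_eq_mul] at h2
  refine h2.trans ?_
  rcases Nat.lt_or_ge P.card 3 with h | h
  · interval_cases P.card <;> simp
  · simp [Nat.sub_eq_zero_of_le h]

lemma sum_residual_eq_zero {P : Finset V} {a b : V} (ha : a ∈ P) (hb : b ∈ P) (hab : a ≠ b)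
    (hxa : 2 ≤ x a) (hxb : 2 ≤ x b) : ∑ v ∈ P, (2 - ∑ u ∈ P.erase v, x u) = 0 := by
  refine Finset.sum_eq_zero fun v _ => Nat.sub_eq_zero_of_le ?_
  by_cases hav : a = v
  · exact hxb.trans (Finset.single_le_sum (f := x) (fun _ _ => Nat.zero_le _)
      (Finset.mem_erase.2 ⟨fun h => hab (hav.trans h.symm), hb⟩))
  · exact hxa.trans (Finset.single_le_sum (f := x) (fun _ _ => Nat.zero_le _)
      (Finset.mem_erase.2 ⟨hav, ha⟩))

section Deficient

variable [Fintype V] {Ω : Finset α}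

/-- The load on a point by the other sets. -/
lemma sum_erase_filter_eq (v : V) (s : α) :
    ∑ u ∈ Finset.univ.erase v with s ∈ K u, x u
      = ∑ u ∈ (Finset.univ.filter fun u => x u ≠ 0 ∧ s ∈ K u).erase v, x u := by
  refine (Finset.sum_subset ?_ ?_).symm
  · intro u hu
    simp only [Finset.mem_erase, Finset.mem_filter, Finset.mem_univ, true_and] at hu
    simp [hu.1, hu.2.2]
  · intro u hu hu'
    simp only [Finset.mem_erase, Finset.mem_filter, Finset.mem_univ, true_and, and_true] at hu hu'
    by_contra h
    exact hu' ⟨hu.1, h, hu.2⟩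

/-- If Hall's condition fails everywhere, the total multiplicity, the size of the support and the
number of points carrying no residual capacity are jointly bounded by the number of points. -/
lemma sum_add_card_le (hΩ : ∀ v, K v ⊆ Ω) (h2 : ∀ u v, u ≠ v → (K u ∩ K v).card ≤ 2)
    (hfail : ∀ v, ¬HallAt K x v) {Z : Finset α} (hZ : Z ⊆ Ω)
    (hZ0 : ∀ s ∈ Z, (∀ u, s ∈ K u → x u = 0) ∨
      ∃ a b, a ≠ b ∧ s ∈ K a ∧ s ∈ K b ∧ 2 ≤ x a ∧ 2 ≤ x b) :
    ∑ v, x v + (Finset.univ.filter fun v => x v ≠ 0).card + Z.card ≤ Ω.card := by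
  set P : α → Finset V := fun s => Finset.univ.filter fun u => x u ≠ 0 ∧ s ∈ K u with hP
  have h1 : ∑ v with x v ≠ 0, 2 * (x v + 1)
      ≤ ∑ v with x v ≠ 0, ∑ s ∈ K v, (2 - ∑ u ∈ (P s).erase v, x u) := by
    refine Finset.sum_le_sum fun v _ => ?_
    simp_rw [hP, ← sum_erase_filter_eq]
    exact two_mul_succ_le_of_deficient h2 (exists_deficient (hfail v))
  have h3 : ∑ v with x v ≠ 0, ∑ s ∈ K v, (2 - ∑ u ∈ (P s).erase v, x u)
      = ∑ s ∈ Ω, ∑ v ∈ P s, (2 - ∑ u ∈ (P s).erase v, x u) := by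
    refine Finset.sum_comm' fun v s => ?_
    simp only [hP, Finset.mem_filter, Finset.mem_univ, true_and]
    exact ⟨fun h => ⟨h, hΩ v h.2⟩, fun h => h.1⟩
  have h5 : ∑ s ∈ Ω, ∑ v ∈ P s, (2 - ∑ u ∈ (P s).erase v, x u) ≤ ∑ s ∈ Ω \ Z, 2 := by
    rw [← Finset.sum_sdiff hZ]
    have : ∑ s ∈ Z, ∑ v ∈ P s, (2 - ∑ u ∈ (P s).erase v, x u) = 0 := by
      refine Finset.sum_eq_zero fun s hs => ?_
      rcases hZ0 s hs with h | ⟨a, b, hab, ha, hb, hxa, hxb⟩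
      · refine Finset.sum_eq_zero fun v hv => ?_
        simp only [hP, Finset.mem_filter, Finset.mem_univ, true_and] at hv
        exact absurd (h v hv.2) hv.1
      · exact sum_residual_eq_zero (by simp [hP, ha]; omega) (by simp [hP, hb]; omega) hab hxa hxb
    rw [this, add_zero]
    exact Finset.sum_le_sum fun s _ => sum_residual_le_two fun u hu => by
      simp only [hP, Finset.mem_filter, Finset.mem_univ, true_and] at hu
      exact hu.1
  have h6 : ∑ v with x v ≠ 0, 2 * (x v + 1)
      = 2 * (∑ v, x v + (Finset.univ.filter fun v => x v ≠ 0).card) := by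
    rw [← Finset.mul_sum, Finset.sum_add_distrib, Finset.sum_filter_ne_zero, Finset.sum_const,
      smul_eq_mul, mul_one]
  rw [Finset.sum_const, smul_eq_mul, Finset.card_sdiff_of_subset hZ] at h5
  have := Finset.card_le_card hZ
  omega

/-- A stronger bound if `K v` shares two points with a set of multiplicity at least two. -/
lemma add_three_le_card_of_not_hallAt (h2 : ∀ u v, u ≠ v → (K u ∩ K v).card ≤ 2) {u v : V}
    (hv : ¬HallAt K x v) (huv : u ≠ v) (hu : 2 ≤ x u) (hK : 2 ≤ (K u ∩ K v).card) :
    x v + 3 ≤ (K v).card := by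
  have h1 := two_mul_succ_le_of_deficient h2 (exists_deficient hv)
  have h3 : ∑ s ∈ K v, (2 - ∑ u ∈ Finset.univ.erase v with s ∈ K u, x u)
      ≤ ∑ s ∈ K v \ (K u ∩ K v), 2 := by
    rw [← Finset.sum_sdiff (Finset.inter_subset_right : K u ∩ K v ⊆ K v)]
    have : ∑ s ∈ K u ∩ K v, (2 - ∑ u ∈ Finset.univ.erase v with s ∈ K u, x u) = 0 := by
      refine Finset.sum_eq_zero fun s hs => Nat.sub_eq_zero_of_le ?_
      exact hu.trans (Finset.single_le_sum (f := x) (fun _ _ => Nat.zero_le _)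
        (by simp [huv, (Finset.mem_inter.1 hs).1]))
    rw [this, add_zero]
    exact Finset.sum_le_sum fun s _ => Nat.sub_le _ _
  rw [Finset.sum_const, smul_eq_mul, Finset.card_sdiff_of_subset Finset.inter_subset_right] at h3
  have := Finset.card_le_card (Finset.inter_subset_right : K u ∩ K v ⊆ K v)
  omega

/-- A configuration of eight-point subsets of a set of forty points, of total multiplicity at
least `32`, satisfies Hall's condition at one of its members. -/
theorem exists_hallAt (hΩ : ∀ v, K v ⊆ Ω) (hΩ40 : Ω.card = 40) (h8 : ∀ v, (K v).card = 8)
    (h2 : ∀ u v, u ≠ v → ¬Disjoint (K u) (K v) → (K u ∩ K v).card = 2)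
    (h3 : ∀ s ∈ Ω, ∀ t ∈ Ω, s ≠ t → (Finset.univ.filter fun u => s ∈ K u ∧ t ∈ K u).card ≤ 3)
    (h4 : ∀ I : Finset V, I.card = 4 → (∀ u ∈ I, ∀ w ∈ I, u ≠ w → Disjoint (K u) (K w)) →
      ∃ v ∉ I, K v ⊆ I.biUnion K)
    (hx : 32 ≤ ∑ v, x v) : ∃ v, HallAt K x v := by
  by_contra! hfail
  have h2' : ∀ u v, u ≠ v → (K u ∩ K v).card ≤ 2 := fun u v huv => by
    by_cases hd : Disjoint (K u) (K v)
    · simp [Finset.disjoint_iff_inter_eq_empty.1 hd]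
    · exact (h2 u v huv hd).le
  have h7 : ∀ v, x v ≤ 7 := fun v => by
    have := lt_card_of_not_hallAt (hfail v)
    have := h8 v
    omega
  set U := Finset.univ.filter fun v => x v ≠ 0 with hU
  set B := Finset.univ.filter fun v => 2 ≤ x v with hB
  have hBU : B ⊆ U := fun v hv => by
    simp only [hB, hU, Finset.mem_filter, Finset.mem_univ, true_and] at hv ⊢
    omega
  have hBcard := Finset.card_le_card hBU
  have hsum : ∑ v, x v = ∑ v ∈ B, x v + (U.card - B.card) := by
    rw [← Finset.card_sdiff_of_subset hBU, ← Finset.sum_filter_ne_zero, ← hU,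
      ← Finset.sum_sdiff hBU, add_comm, Finset.card_eq_sum_ones]
    congr 1
    refine Finset.sum_congr rfl fun v hv => ?_
    simp only [hB, hU, Finset.mem_sdiff, Finset.mem_filter, Finset.mem_univ, true_and] at hv
    omega
  have hU8 := sum_add_card_le hΩ h2' hfail (Z := ∅) (by simp) (by simp)
  rw [← hU, Finset.card_empty] at hU8
  have hB4 : 4 ≤ B.card := by
    have : ∑ v ∈ B, x v ≤ B.card * 7 := Finset.sum_le_card_nsmul B x 7 fun v _ => h7 v
    omega
  have hxB : ∀ {v}, v ∈ B → 2 ≤ x v := fun hv => (Finset.mem_filter.1 hv).2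
  obtain ⟨a, haB, b, hbB, hab, hdab⟩ : ∃ a ∈ B, ∃ b ∈ B, a ≠ b ∧ ¬Disjoint (K a) (K b) := by
    by_contra! h
    have := card_le_three_of_pairwise_disjoint h2' h4 hfail (fun u hu => hxB hu) h
    omega
  obtain ⟨s, t, hst, hSt⟩ := Finset.card_eq_two.1 (h2 a b hab hdab)
  have hs : s ∈ K a ∧ s ∈ K b := Finset.mem_inter.1 (hSt ▸ Finset.mem_insert_self s {t})
  have ht : t ∈ K a ∧ t ∈ K b :=
    Finset.mem_inter.1 (hSt ▸ Finset.mem_insert_of_mem (Finset.mem_singleton_self t))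
  have hU6 : ∑ v, x v + U.card + 2 ≤ Ω.card := by
    rw [← Finset.card_pair hst]
    refine sum_add_card_le hΩ h2' hfail ?_ ?_
    · simp [Finset.insert_subset_iff, hΩ a hs.1, hΩ a ht.1]
    · intro r hr
      rcases Finset.mem_insert.1 hr with rfl | hr
      · exact Or.inr ⟨a, b, hab, hs.1, hs.2, hxB haB, hxB hbB⟩
      · rw [Finset.mem_singleton.1 hr]
        exact Or.inr ⟨a, b, hab, ht.1, ht.2, hxB haB, hxB hbB⟩
  set R := B.filter fun v => ∀ u ∈ B, u ≠ v → Disjoint (K u) (K v) with hR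
  have hRB : R ⊆ B := Finset.filter_subset _ _
  have haR : a ∉ R := fun h => hdab ((Finset.mem_filter.1 h).2 b hbB hab.symm).symm
  have hR2 : R.card ≤ 2 := by
    have := card_le_three_of_pairwise_disjoint h2' h4 hfail (I := insert a R)
      (fun u hu => (Finset.mem_insert.1 hu).elim (fun h => h ▸ hxB haB) fun h => hxB (hRB h)) ?_
    · rw [Finset.card_insert_of_notMem haR] at this
      omega
    · intro u hu w hw huw
      rcases Finset.mem_insert.1 hw with rfl | hw
      · rcases Finset.mem_insert.1 hu with rfl | hu
        · exact absurd rfl huw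
        · exact ((Finset.mem_filter.1 hu).2 w haB huw.symm).symm
      · refine (Finset.mem_filter.1 hw).2 u ?_ huw
        exact (Finset.mem_insert.1 hu).elim (fun h => h ▸ haB) fun h => hRB h
  have h5 : ∀ v ∈ B \ R, x v ≤ 5 := by
    intro v hv
    obtain ⟨hvB, hvR⟩ := Finset.mem_sdiff.1 hv
    obtain ⟨u, huB, huv, hd⟩ : ∃ u ∈ B, u ≠ v ∧ ¬Disjoint (K u) (K v) := by
      by_contra! h
      exact hvR (Finset.mem_filter.2 ⟨hvB, h⟩)
    have := add_three_le_card_of_not_hallAt h2' (hfail v) huv (hxB huB) (h2 u v huv hd).ge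
    have := h8 v
    omega
  have hBsum : ∑ v ∈ B, x v ≤ (B.card - R.card) * 5 + R.card * 7 := by
    rw [← Finset.sum_sdiff hRB, ← Finset.card_sdiff_of_subset hRB]
    exact add_le_add (Finset.sum_le_card_nsmul _ x 5 h5)
      (Finset.sum_le_card_nsmul _ x 7 fun v _ => h7 v)
  have hB6 : B.card = 6 ∧ U.card = 6 := by omega
  have hUB : B = U := Finset.eq_of_subset_of_card_le hBU (by omega)
  have hone : ∀ r ∈ Ω \ {s, t}, (B.filter fun u => r ∈ K u).card = 1 := by
    intro r hr
    obtain ⟨hrΩ, hrst⟩ := Finset.mem_sdiff.1 hr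
    have hbad : ¬((∀ u, r ∈ K u → x u = 0) ∨
        ∃ a b, a ≠ b ∧ r ∈ K a ∧ r ∈ K b ∧ 2 ≤ x a ∧ 2 ≤ x b) := by
      intro hr0
      have := sum_add_card_le hΩ h2' hfail (Z := insert r {s, t}) ?_ ?_
      · rw [← hU, Finset.card_insert_of_notMem hrst, Finset.card_pair hst] at this
        omega
      · simp [Finset.insert_subset_iff, hrΩ, hΩ a hs.1, hΩ a ht.1]
      · intro q hq
        simp only [Finset.mem_insert, Finset.mem_singleton] at hq
        rcases hq with rfl | rfl | rfl
        · exact hr0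
        · exact Or.inr ⟨a, b, hab, hs.1, hs.2, hxB haB, hxB hbB⟩
        · exact Or.inr ⟨a, b, hab, ht.1, ht.2, hxB haB, hxB hbB⟩
    push Not at hbad
    obtain ⟨⟨u, hru, hxu⟩, hu2⟩ := hbad
    refine Finset.card_eq_one.2 ⟨u, ?_⟩
    have huB : u ∈ B := hUB ▸ Finset.mem_filter.2 ⟨Finset.mem_univ u, hxu⟩
    ext w
    simp only [Finset.mem_filter, Finset.mem_singleton]
    refine ⟨fun h => ?_, fun h => h ▸ ⟨huB, hru⟩⟩
    by_contra hwu
    have := hu2 w u hwu h.2 hru (hxB h.1)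
    have := hxB huB
    omega
  have hsΩ : ({s, t} : Finset α) ⊆ Ω := by
    simp [Finset.insert_subset_iff, hΩ a hs.1, hΩ a ht.1]
  have hcount : ∑ r ∈ Ω, (B.filter fun u => r ∈ K u).card = 48 := by
    have : ∑ r ∈ Ω, (B.filter fun u => r ∈ K u).card = ∑ u ∈ B, (K u).card := by
      simp_rw [Finset.card_eq_sum_ones]
      refine Finset.sum_comm' fun r u => ?_
      simp only [Finset.mem_filter]
      exact ⟨fun h => ⟨h.2.2, h.2.1⟩, fun h => ⟨hΩ u h.1, h.2, h.1⟩⟩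
    rw [this, Finset.sum_congr rfl fun u _ => h8 u, Finset.sum_const, hB6.1]
    rfl
  rw [← Finset.sum_sdiff hsΩ, Finset.sum_congr rfl hone, Finset.sum_pair hst, Finset.sum_const,
    Finset.card_sdiff_of_subset hsΩ, Finset.card_pair hst, hΩ40,
    ← Finset.card_union_add_card_inter] at hcount
  have hun : (B.filter (fun u => s ∈ K u) ∪ B.filter fun u => t ∈ K u).card ≤ B.card :=
    Finset.card_le_card (Finset.union_subset (Finset.filter_subset _ _) (Finset.filter_subset _ _))
  have hin : (B.filter (fun u => s ∈ K u) ∩ B.filter fun u => t ∈ K u).card ≤ 3 := by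
    refine (Finset.card_le_card fun u hu => ?_).trans (h3 s (hΩ a hs.1) t (hΩ a ht.1) hst)
    simp only [Finset.mem_inter, Finset.mem_filter] at hu
    simp [hu.1.2, hu.2.2]
  simp only [smul_eq_mul] at hcount
  omega

end Deficient

section Frame

variable [Fintype V] {β : Type*} [DecidableEq β] {O : V → Finset β} {Ω : Finset α} {D : Finset β}

/-- If some `e` lies in many of the `O u`, then Hall's condition holds at a member of maximal
multiplicity among those with `e ∈ O u`. -/
lemma hallAt_of_heavy {e : β} {v : V} (hv : e ∈ O v) (hmax : ∀ u, e ∈ O u → x u ≤ x v)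
    (h8 : (K v).card = 8) (h2 : ∀ u, u ≠ v → (K u ∩ K v).card ≤ 2)
    (hA : (Finset.univ.filter fun u => e ∈ O u).card ≤ 6)
    (hcov : K v ⊆ ((Finset.univ.filter fun u => e ∈ O u).erase v).biUnion K)
    (hheavy : 19 ≤ ∑ u with e ∈ O u, x u) : HallAt K x v := by
  intro T hT
  rcases T.eq_empty_or_nonempty with rfl | ⟨s₀, hs₀⟩
  · simp
  set A := Finset.univ.filter fun u => e ∈ O u with hAdef
  have hvA : v ∈ A := by simp [hAdef, hv]
  have h1 := card_le_two_mul_card (hT.trans hcov) fun u hu =>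
    (Finset.card_le_card (Finset.inter_subset_inter_left hT)).trans
      (h2 u (Finset.ne_of_mem_erase hu))
  have hvT : v ∈ A.filter fun u => ¬Disjoint (K u) T :=
    Finset.mem_filter.2 ⟨hvA, Finset.not_disjoint_iff.2 ⟨s₀, hT hs₀, hs₀⟩⟩
  rw [Finset.filter_erase, Finset.card_erase_of_mem hvT] at h1
  have h3 := Finset.card_filter_add_card_filter_not (s := A) fun u => Disjoint (K u) T
  have h4 := Finset.sum_filter_add_sum_filter_not A (fun u => Disjoint (K u) T) x
  have h5 : ∑ u ∈ A with Disjoint (K u) T, x u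
      ≤ (A.filter fun u => Disjoint (K u) T).card * x v :=
    Finset.sum_le_card_nsmul _ x _ fun u hu =>
      hmax u (Finset.mem_filter.1 (Finset.mem_filter.1 hu).1).2
  have h6 : x v ≤ ∑ u ∈ A with ¬Disjoint (K u) T, x u :=
    Finset.single_le_sum (f := x) (fun _ _ => Nat.zero_le _) hvT
  have h7 : ∑ u ∈ A with ¬Disjoint (K u) T, x u ≤ ∑ u with ¬Disjoint (K u) T, x u :=
    Finset.sum_le_sum_of_subset (Finset.filter_subset_filter _ (Finset.subset_univ _))
  have h9 := Finset.card_le_card hT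
  have h10 := Finset.card_pos.2 ⟨v, hvT⟩
  generalize (A.filter fun u => Disjoint (K u) T).card = c at *
  have hc : c ≤ 5 := by omega
  interval_cases c <;> omega

/-- A configuration with the incidence properties of the thirty varieties satisfies the full Hall
condition at one of its members. -/
theorem exists_frameHallAt {k : ℕ} (hk : 2 ≤ k) (hx : ∑ v, x v = 12 * k + 8)
    (hΩ : ∀ v, K v ⊆ Ω) (hΩ40 : Ω.card = 40) (h8 : ∀ v, (K v).card = 8)
    (h2 : ∀ u v, u ≠ v → ¬Disjoint (K u) (K v) → (K u ∩ K v).card = 2)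
    (h3 : ∀ s ∈ Ω, ∀ t ∈ Ω, s ≠ t → (Finset.univ.filter fun u => s ∈ K u ∧ t ∈ K u).card ≤ 3)
    (h4 : ∀ I : Finset V, I.card = 4 → (∀ u ∈ I, ∀ w ∈ I, u ≠ w → Disjoint (K u) (K w)) →
      ∃ v ∉ I, K v ⊆ I.biUnion K)
    (hO3 : ∀ v, (O v).card = 3) (hD : ∀ v, (D \ O v).card = 12)
    (hA : ∀ e, (Finset.univ.filter fun u => e ∈ O u).card ≤ 6)
    (hAA : ∀ e e', e ≠ e' → (Finset.univ.filter fun u => e ∈ O u ∧ e' ∈ O u).card ≤ 2)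
    (hO : ∀ u w e₁ e₂, e₁ ≠ e₂ → e₁ ∈ O u → e₂ ∈ O u → e₁ ∈ O w → e₂ ∈ O w → O u = O w)
    (hcov : ∀ v, ∀ e ∈ O v, K v ⊆ ((Finset.univ.filter fun u => e ∈ O u).erase v).biUnion K)
    (hK : ∀ u v, O u ≠ O v → ¬Disjoint (O u) (O v) → 2 ≤ (K u ∩ K v).card)
    (hKK : ∀ u v w, u ≠ w → O u = O w → O u ≠ O v → ¬Disjoint (O u) (O v) →
      (K v \ (K u ∪ K w)).card ≤ 5) :
    ∃ v, FrameHallAt K O D x k v := by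
  by_cases hlight : ∀ e, ∑ u with e ∈ O u, x u ≤ 9 * k
  · obtain ⟨v, hv⟩ := exists_hallAt hΩ hΩ40 h8 h2 h3 h4 (x := x) (by omega)
    exact ⟨v, frameHallAt_of_light (h8 v) hO3 (hD v) hx hlight hv⟩
  · push Not at hlight
    obtain ⟨e, he⟩ := hlight
    obtain ⟨v, hv, hmax⟩ := Finset.exists_max_image (Finset.univ.filter fun u => e ∈ O u) x
      (Finset.nonempty_iff_ne_empty.2 fun h => by simp [h] at he)
    simp only [Finset.mem_filter, Finset.mem_univ, true_and] at hv hmax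
    have hdO : ∀ u, e ∈ O u → ¬Disjoint (O u) (O v) := fun u hu =>
      Finset.not_disjoint_iff.2 ⟨e, hu, hv⟩
    have hHall : HallAt K x v := hallAt_of_heavy hv hmax (h8 v) (fun u huv => by
      by_cases hd : Disjoint (K u) (K v)
      · simp [Finset.disjoint_iff_inter_eq_empty.1 hd]
      · exact (h2 u v huv hd).le) (hA e) (hcov v e hv) (by omega)
    exact ⟨v, frameHallAt_of_heavy hk hv hmax (h8 v) hO3 (hD v) hx (hAA e) hO
      (fun u hu huv => hK u v huv (hdO u hu))
      (fun u w huw hu hOuw huv => hKK u v w huw hOuw huv (hdO u hu)) he hHall⟩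

end Frame

end Counting

/-- The set of positions below `k` at which the binary digit of `m` is one. -/
def bits (k m : ℕ) : Finset ℕ := (Finset.range k).filter fun i => m.testBit i

/-- The number of ones among the `k` lowest binary digits of `m`. -/
def popCount : ℕ → ℕ → ℕ
  | 0, _ => 0
  | k + 1, m => m % 2 + popCount k (m / 2)

/-- A numerical code for the cyclic class of a triple of colors. -/
def cornerCode (x y z : Fin 6) : ℕ :=
  min (36 * x.val + 6 * y.val + z.val)
    (min (36 * y.val + 6 * z.val + x.val) (36 * z.val + 6 * x.val + y.val))

/-- A numerical code for an unordered pair of colors. -/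
def pairCode (x y : Fin 6) : ℕ := 6 * min x.val y.val + max x.val y.val

/-- The number whose binary digits record the corners of a coloring of the faces. -/
def cornerMask (c : Fin 6 → Fin 6) : ℕ :=
  2 ^ cornerCode (c 0) (c 1) (c 2) ||| 2 ^ cornerCode (c 0) (c 2) (c 4) |||
    2 ^ cornerCode (c 0) (c 4) (c 5) ||| 2 ^ cornerCode (c 0) (c 5) (c 1) |||
    2 ^ cornerCode (c 1) (c 3) (c 2) ||| 2 ^ cornerCode (c 3) (c 4) (c 2) |||
    2 ^ cornerCode (c 3) (c 1) (c 5) ||| 2 ^ cornerCode (c 3) (c 5) (c 4)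

/-- The number whose binary digits record the opposite pairs of a coloring of the faces. -/
def oppMask (c : Fin 6 → Fin 6) : ℕ :=
  2 ^ pairCode (c 0) (c 3) ||| 2 ^ pairCode (c 1) (c 4) ||| 2 ^ pairCode (c 2) (c 5)

/-- Representatives of the thirty varieties. -/
def rep : Fin 30 → Fin 6 → Fin 6 :=
  ![
    ![0, 2, 3, 1, 4, 5], ![0, 2, 3, 1, 5, 4], ![0, 2, 4, 1, 3, 5], ![0, 2, 4, 1, 5, 3],
    ![0, 2, 5, 1, 3, 4], ![0, 2, 5, 1, 4, 3], ![0, 1, 3, 2, 4, 5], ![0, 1, 3, 2, 5, 4],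
    ![0, 1, 4, 2, 3, 5], ![0, 1, 4, 2, 5, 3], ![0, 1, 5, 2, 3, 4], ![0, 1, 5, 2, 4, 3],
    ![0, 1, 2, 3, 4, 5], ![0, 1, 2, 3, 5, 4], ![0, 1, 4, 3, 2, 5], ![0, 1, 4, 3, 5, 2],
    ![0, 1, 5, 3, 2, 4], ![0, 1, 5, 3, 4, 2], ![0, 1, 2, 4, 3, 5], ![0, 1, 2, 4, 5, 3],
    ![0, 1, 3, 4, 2, 5], ![0, 1, 3, 4, 5, 2], ![0, 1, 5, 4, 2, 3], ![0, 1, 5, 4, 3, 2],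
    ![0, 1, 2, 5, 3, 4], ![0, 1, 2, 5, 4, 3], ![0, 1, 3, 5, 2, 4], ![0, 1, 3, 5, 4, 2],
    ![0, 1, 4, 5, 2, 3], ![0, 1, 4, 5, 3, 2]]

/-- The corner masks of the representatives. -/
def repCorner (v : Fin 30) : ℕ :=
  List.getD [
    1189896057552394813440, 627265859717045452800,
    595204733956977131520, 1185782019297083719680,
    304952241576799764480, 332331875520052592640,
    81763463715015946553519211807232, 43100120407764413588723371868672,
    40584626248227059341074158846976, 81169252495863890425788569748480,
    673439381375867562771433392128, 2555108241085105952202399680512,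
    5575186299632675592425148502114444190482688, 174224571863560107374514226603510202499328,
    673439381961830910282195665920, 5575186299673220604591233199492165676311552,
    40584626247941706765086375348224, 174224571864154318593362492418383039965184,
    174224571864154318594547117012551670464768, 5575186299635191086584390926881486952595712,
    2555108242274839880148207141376, 174224571944650131707863708576495114920448,
    81763463714757978115065223088128, 5575186299632675592424595032238244399949824,
    5575186299673220604591564950403311688777984, 174224571944650131708150205066786120466688,
    81169252496491003163091936543232, 5575186299635191086584976331782641814610432,
    43100120408940967732357691376640, 174224571863560107375685531801778897560576] v 0

/-- The masks of the opposite pairs of the representatives. -/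
def repOpp (v : Fin 30) : ℕ :=
  List.getD [
    8454146, 4325378, 536903682, 4325378, 536903682, 8454146, 8389636, 4196356,
    536871428, 4196356, 536871428, 8389636, 132104, 67592, 536871176, 67592,
    536871176, 132104, 131600, 34832, 8388880, 34832, 8388880, 131600,
    66080, 33824, 4194592, 33824, 4194592, 66080] v 0

/-- The mask of all corners. -/
def fullCorner : ℕ := 5749410871621099283923661377861588482764544

/-- The mask of all pairs. -/
def fullPair : ℕ := 549687102

set_option maxRecDepth 100000

lemma cornerMask_rep : ∀ v, cornerMask (rep v) = repCorner v := by decide +kernel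

lemma oppMask_rep : ∀ v, oppMask (rep v) = repOpp v := by decide +kernel

lemma rep_injective : ∀ v, Function.Injective (rep v) := by decide +kernel

lemma land_fullCorner : ∀ v, repCorner v &&& fullCorner = repCorner v := by decide +kernel

lemma popCount_fullCorner : popCount 144 fullCorner = 40 := by decide +kernel

lemma popCount_fullPair : popCount 36 fullPair = 15 := by decide +kernel

lemma land_fullPair : ∀ v, repOpp v &&& fullPair = repOpp v := by decide +kernel

lemma popCount_repCorner : ∀ v, popCount 144 (repCorner v) = 8 := by decide +kernel

lemma popCount_repOpp : ∀ v, popCount 36 (repOpp v) = 3 := by decide +kernel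

lemma popCount_repCorner_land : ∀ u v, u < v →
    repCorner u &&& repCorner v = 0 ∨ popCount 144 (repCorner u &&& repCorner v) = 2 := by
  decide +kernel

/-- Two corners lie on at most three common varieties. -/
lemma two_corners : ∀ s < 144, fullCorner.testBit s → ∀ t < s, fullCorner.testBit t →
    (Finset.univ.filter fun u => (repCorner u).testBit s ∧ (repCorner u).testBit t).card ≤ 3 := by
  decide +kernel

/-- Four varieties without common corners cover the corners of a fifth. -/
lemma four_disjoint : ∀ a b, a < b → repCorner a &&& repCorner b = 0 →
    ∀ c, b < c → (repCorner a ||| repCorner b) &&& repCorner c = 0 →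
    ∀ d, c < d → (repCorner a ||| repCorner b ||| repCorner c) &&& repCorner d = 0 →
    ∃ v, (v ≠ a ∧ v ≠ b ∧ v ≠ c ∧ v ≠ d) ∧
      repCorner v &&& (repCorner a ||| repCorner b ||| repCorner c ||| repCorner d) =
        repCorner v := by
  decide +kernel

lemma one_pair : ∀ s < 36, (Finset.univ.filter fun u => (repOpp u).testBit s).card ≤ 6 := by
  decide +kernel

lemma two_pairs : ∀ s < 36, fullPair.testBit s → ∀ t < s, fullPair.testBit t →
    (Finset.univ.filter fun u => (repOpp u).testBit s ∧ (repOpp u).testBit t).card ≤ 2 := by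
  decide +kernel

lemma opp_eq : ∀ u v, u < v →
    popCount 36 (repOpp u &&& repOpp v) ≤ 1 ∨ repOpp u = repOpp v := by
  decide +kernel

/-- Every corner of a variety lies on another variety with a prescribed common opposite pair. -/
lemma exists_ne_testBit : ∀ v (e : Fin 36), (repOpp v).testBit e →
    ∀ s : Fin 144, (repCorner v).testBit s →
    ∃ u, u ≠ v ∧ (repOpp u).testBit e ∧ (repCorner u).testBit s := by
  decide +kernel

lemma repCorner_land_ne_zero : ∀ u v, repOpp u ≠ repOpp v → repOpp u &&& repOpp v ≠ 0 →
    repCorner u &&& repCorner v ≠ 0 := by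
  decide +kernel

lemma three_le_popCount_land : ∀ u w, u < w → repOpp u = repOpp w → ∀ v, repOpp u ≠ repOpp v →
    repOpp u &&& repOpp v ≠ 0 →
    3 ≤ popCount 144 (repCorner v &&& (repCorner u ||| repCorner w)) := by
  decide +kernel

/-- Every bijective coloring is described by one of the representatives. -/
lemma exists_rep : ∀ a b, a ≠ b → ∀ c, (a ≠ c ∧ b ≠ c) → ∀ d, (a ≠ d ∧ b ≠ d ∧ c ≠ d) →
    ∀ e, (a ≠ e ∧ b ≠ e ∧ c ≠ e ∧ d ≠ e) → ∀ f, (a ≠ f ∧ b ≠ f ∧ c ≠ f ∧ d ≠ f ∧ e ≠ f) →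
    ∃ v, oppMask ![a, b, c, d, e, f] = repOpp v ∧
      cornerMask ![a, b, c, d, e, f] = repCorner v := by
  decide +kernel

lemma mem_bits {k m i : ℕ} : i ∈ bits k m ↔ i < k ∧ m.testBit i := by
  simp [bits]

lemma bits_land (k a b : ℕ) : bits k (a &&& b) = bits k a ∩ bits k b := by
  ext i
  simp only [mem_bits, Finset.mem_inter, Nat.testBit_and, Bool.and_eq_true]
  tauto

lemma bits_lor (k a b : ℕ) : bits k (a ||| b) = bits k a ∪ bits k b := by
  ext i
  simp only [mem_bits, Finset.mem_union, Nat.testBit_or, Bool.or_eq_true]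
  tauto

lemma bits_zero (k : ℕ) : bits k 0 = ∅ := by
  ext i
  simp [mem_bits]

lemma bits_subset {k a b : ℕ} (h : a &&& b = a) : bits k a ⊆ bits k b := by
  rw [← h, bits_land]
  exact Finset.inter_subset_right

lemma disjoint_bits {k a b : ℕ} (h : a &&& b = 0) : Disjoint (bits k a) (bits k b) := by
  rw [Finset.disjoint_iff_inter_eq_empty, ← bits_land, h, bits_zero]

lemma card_bits (k m : ℕ) : (bits k m).card = popCount k m := by
  induction k generalizing m with
  | zero => simp [bits, popCount]
  | succ k ih =>
    rw [popCount, ← ih, bits, Finset.card_filter, Finset.sum_range_succ', bits, Finset.card_filter,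
      add_comm]
    congr 1
    · rw [Nat.testBit_zero]
      rcases Nat.mod_two_eq_zero_or_one m with h | h <;> simp [h]
    · simp only [Nat.testBit_succ]

/-- The corner codes of a representative. -/
def corners (v : Fin 30) : Finset ℕ := bits 144 (repCorner v)

/-- The codes of the opposite pairs of a representative. -/
def opps (v : Fin 30) : Finset ℕ := bits 36 (repOpp v)

lemma card_corners_inter {u v : Fin 30} (huv : u ≠ v) (h : repCorner u &&& repCorner v ≠ 0) :
    (corners u ∩ corners v).card = 2 := by
  rw [corners, corners, ← bits_land, card_bits]
  rcases huv.lt_or_gt with h' | h'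
  · exact (popCount_repCorner_land u v h').resolve_left h
  · rw [Nat.land_comm] at h ⊢
    exact (popCount_repCorner_land v u h').resolve_left h

lemma land_ne_zero_of_not_disjoint {k a b : ℕ} (h : ¬Disjoint (bits k a) (bits k b)) :
    a &&& b ≠ 0 :=
  fun h' => h (disjoint_bits h')

lemma repOpp_eq_of_two_le {u v : Fin 30} (h : 2 ≤ (opps u ∩ opps v).card) :
    repOpp u = repOpp v := by
  rw [opps, opps, ← bits_land, card_bits] at h
  rcases lt_trichotomy u v with h' | rfl | h'
  · exact (opp_eq u v h').resolve_left (by omega)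
  · rfl
  · rw [Nat.land_comm] at h
    exact ((opp_eq v u h').resolve_left (by omega)).symm

lemma card_opps (v : Fin 30) : (opps v).card = 3 := by
  rw [opps, card_bits, popCount_repOpp]

lemma repOpp_eq_of_opps_eq {u v : Fin 30} (h : opps u = opps v) : repOpp u = repOpp v :=
  repOpp_eq_of_two_le (by rw [h, Finset.inter_self, card_opps]; omega)

lemma two_corners_le {s t : ℕ} (hs : s ∈ bits 144 fullCorner) (ht : t ∈ bits 144 fullCorner)
    (hst : s ≠ t) : (Finset.univ.filter fun u => s ∈ corners u ∧ t ∈ corners u).card ≤ 3 := by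
  rw [mem_bits] at hs ht
  rcases hst.lt_or_gt with h | h
  · refine (Finset.card_le_card fun u hu => ?_).trans (two_corners t ht.1 ht.2 s h hs.2)
    simp only [corners, mem_bits, Finset.mem_filter] at hu ⊢
    tauto
  · refine (Finset.card_le_card fun u hu => ?_).trans (two_corners s hs.1 hs.2 t h ht.2)
    simp only [corners, mem_bits, Finset.mem_filter] at hu ⊢
    tauto

lemma opps_subset (v : Fin 30) : opps v ⊆ bits 36 fullPair := bits_subset (land_fullPair v)

lemma card_sdiff_opps (v : Fin 30) : (bits 36 fullPair \ opps v).card = 12 := by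
  rw [Finset.card_sdiff_of_subset (opps_subset v), card_opps, card_bits, popCount_fullPair]

lemma two_pairs_le {s t : ℕ} (hst : s ≠ t) :
    (Finset.univ.filter fun u => s ∈ opps u ∧ t ∈ opps u).card ≤ 2 := by
  by_cases hs : s ∈ bits 36 fullPair ∧ t ∈ bits 36 fullPair
  · rw [mem_bits, mem_bits] at hs
    obtain ⟨hs, ht⟩ := hs
    rcases hst.lt_or_gt with h | h
    · refine (Finset.card_le_card fun u hu => ?_).trans (two_pairs t ht.1 ht.2 s h hs.2)
      simp only [opps, mem_bits, Finset.mem_filter] at hu ⊢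
      tauto
    · refine (Finset.card_le_card fun u hu => ?_).trans (two_pairs s hs.1 hs.2 t h ht.2)
      simp only [opps, mem_bits, Finset.mem_filter] at hu ⊢
      tauto
  · rw [Finset.filter_false_of_mem]
    · simp
    · exact fun u _ h => hs ⟨opps_subset u h.1, opps_subset u h.2⟩

lemma one_pair_le (s : ℕ) : (Finset.univ.filter fun u => s ∈ opps u).card ≤ 6 := by
  by_cases hs : s < 36
  · refine (Finset.card_le_card fun u hu => ?_).trans (one_pair s hs)
    simp only [opps, mem_bits, Finset.mem_filter] at hu ⊢
    tauto
  · rw [Finset.filter_false_of_mem]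
    · simp
    · exact fun u _ h => hs (mem_bits.1 h).1

lemma exists_subset_biUnion {I : Finset (Fin 30)} (hI : I.card = 4)
    (h : ∀ u ∈ I, ∀ w ∈ I, u ≠ w → Disjoint (corners u) (corners w)) :
    ∃ v ∉ I, corners v ⊆ I.biUnion corners := by
  have hlt : ∀ i j, i < j → I.orderEmbOfFin hI i < I.orderEmbOfFin hI j :=
    fun i j hij => (I.orderEmbOfFin hI).strictMono hij
  have hmem := I.orderEmbOfFin_mem hI
  have hland : ∀ i j, i < j →
      repCorner (I.orderEmbOfFin hI i) &&& repCorner (I.orderEmbOfFin hI j) = 0 := by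
    intro i j hij
    by_contra h0
    have h2 := card_corners_inter (hlt i j hij).ne h0
    rw [Finset.disjoint_iff_inter_eq_empty.1 (h _ (hmem i) _ (hmem j) (hlt i j hij).ne)] at h2
    simp at h2
  obtain ⟨v, hv, hsub⟩ := four_disjoint _ _ (hlt 0 1 (by decide)) (hland 0 1 (by decide))
    _ (hlt 1 2 (by decide))
    (by rw [Nat.and_or_distrib_right, hland 0 2 (by decide), hland 1 2 (by decide)]; rfl)
    _ (hlt 2 3 (by decide))
    (by rw [Nat.and_or_distrib_right, Nat.and_or_distrib_right, hland 0 3 (by decide),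
          hland 1 3 (by decide), hland 2 3 (by decide)]; rfl)
  have hrange : ∀ w, w ∈ I ↔ ∃ i, I.orderEmbOfFin hI i = w := fun w => by
    rw [← Finset.mem_coe, ← Finset.range_orderEmbOfFin I hI, Set.mem_range]
  refine ⟨v, fun hvI => ?_, fun s hs => ?_⟩
  · obtain ⟨i, rfl⟩ := (hrange v).1 hvI
    fin_cases i <;> simp at hv
  · have := bits_subset (k := 144) hsub hs
    simp only [bits_lor, Finset.mem_union] at this
    simp only [Finset.mem_biUnion]
    rcases this with ((h | h) | h) | h
    exacts [⟨_, hmem 0, h⟩, ⟨_, hmem 1, h⟩, ⟨_, hmem 2, h⟩, ⟨_, hmem 3, h⟩]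

/-- Every distribution of `12 * k + 8` cubes over the varieties satisfies Hall's condition for the
frame of some variety. -/
theorem exists_frameHallAt_corners {k : ℕ} (hk : 2 ≤ k) {x : Fin 30 → ℕ}
    (hx : ∑ v, x v = 12 * k + 8) :
    ∃ v, FrameHallAt corners opps (bits 36 fullPair) x k v := by
  refine exists_frameHallAt (Ω := bits 144 fullCorner) hk hx
    (fun v => bits_subset (land_fullCorner v)) (by rw [card_bits, popCount_fullCorner])
    (fun v => by rw [corners, card_bits, popCount_repCorner])
    (fun u v huv h => card_corners_inter huv (land_ne_zero_of_not_disjoint h))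
    (fun s hs t ht hst => two_corners_le hs ht hst) (fun I => exists_subset_biUnion)
    card_opps card_sdiff_opps one_pair_le (fun e e' h => two_pairs_le h) ?_ ?_
    (fun u v h h' => ?_) ?_
  · intro u w e₁ e₂ hne h₁ h₂ h₃ h₄
    rw [opps, opps, repOpp_eq_of_two_le]
    exact Finset.one_lt_card.2
      ⟨e₁, Finset.mem_inter.2 ⟨h₁, h₃⟩, e₂, Finset.mem_inter.2 ⟨h₂, h₄⟩, hne⟩
  · intro v e he s hs
    rw [opps, mem_bits] at he
    rw [corners, mem_bits] at hs
    obtain ⟨u, huv, hue, hus⟩ := exists_ne_testBit v ⟨e, he.1⟩ he.2 ⟨s, hs.1⟩ hs.2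
    simp only [Finset.mem_biUnion, Finset.mem_erase, Finset.mem_filter, Finset.mem_univ, true_and,
      opps, corners, mem_bits]
    exact ⟨u, ⟨huv, he.1, hue⟩, hs.1, hus⟩
  · rw [card_corners_inter (fun h'' => h (by rw [h'']))]
    exact repCorner_land_ne_zero u v (fun h'' => h (by rw [opps, opps, h'']))
      (land_ne_zero_of_not_disjoint h')
  · intro u v w huw huw' huv hd
    have key : 3 ≤ (corners v ∩ (corners u ∪ corners w)).card := by
      rw [corners, corners, corners, ← bits_lor, ← bits_land, card_bits]
      have hne : repOpp u ≠ repOpp v := fun h'' => huv (by rw [opps, opps, h''])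
      have hland := land_ne_zero_of_not_disjoint hd
      have heq := repOpp_eq_of_opps_eq huw'
      rcases huw.lt_or_gt with h | h
      · exact three_le_popCount_land u w h heq v hne hland
      · rw [Nat.lor_comm]
        exact three_le_popCount_land w u h heq.symm v (heq ▸ hne) (heq ▸ hland)
    have h8 : (corners v).card = 8 := by rw [corners, card_bits, popCount_repCorner]
    have := Finset.card_inter_add_card_sdiff (corners v) (corners u ∪ corners w)
    omega

lemma cornerCode_lt : ∀ x y z : Fin 6, x ≠ y → y ≠ z → x ≠ z → cornerCode x y z < 144 := by
  decide +kernel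

lemma pairCode_eq : ∀ x y : Fin 6, x ≠ y → ∀ a b : Fin 6,
    a ≠ b → pairCode a b = pairCode x y → a = x ∧ b = y ∨ a = y ∧ b = x := by decide +kernel

lemma testBit_fullPair : ∀ n < 36, fullPair.testBit n → ∃ x y : Fin 6, x ≠ y ∧ pairCode x y = n := by
  decide +kernel

lemma pairCode_mem_fullPair : ∀ x y : Fin 6, x ≠ y →
    pairCode x y < 36 ∧ fullPair.testBit (pairCode x y) := by decide +kernel

lemma cornerCode_cyc (x y z : Fin 6) : cornerCode y z x = cornerCode x y z := by
  simp only [cornerCode]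
  omega

lemma pairCode_comm (x y : Fin 6) : pairCode y x = pairCode x y := by
  rw [pairCode, pairCode, min_comm, max_comm]

lemma digits_eq {x y z a b c : Fin 6}
    (h : 36 * a.val + 6 * b.val + c.val = 36 * x.val + 6 * y.val + z.val) :
    (a, b, c) = (x, y, z) := by
  have := a.2
  have := b.2
  have := c.2
  have := x.2
  have := y.2
  have := z.2
  simp only [Prod.mk.injEq, Fin.ext_iff]
  omega

lemma exists_digits (x y z : Fin 6) : ∃ t ∈ cycClass (x, y, z),
    cornerCode x y z = 36 * t.1.val + 6 * t.2.1.val + t.2.2.val := by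
  simp only [cycClass, cyc, Finset.mem_insert, Finset.mem_singleton, exists_eq_or_imp,
    exists_eq_left, cornerCode]
  omega

lemma cornerCode_eq {x y z a b c : Fin 6} (h : cornerCode a b c = cornerCode x y z) :
    (a, b, c) ∈ cycClass (x, y, z) := by
  obtain ⟨⟨x', y', z'⟩, ht, hx⟩ := exists_digits x y z
  obtain ⟨⟨a', b', c'⟩, hs, ha⟩ := exists_digits a b c
  rw [hx, ha] at h
  rw [digits_eq h] at hs
  simp only [cycClass, cyc, Finset.mem_insert, Finset.mem_singleton, Prod.mk.injEq] at hs ht ⊢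
  rcases hs with h₁ | h₁ | h₁ <;> rcases ht with h₂ | h₂ | h₂ <;>
    simp only [← h₁, h₂, and_self, true_or, or_true]

/-- The cyclic class with a given code. -/
def cornerClass (n : ℕ) : Finset (Fin 6 × Fin 6 × Fin 6) :=
  Finset.univ.filter fun t =>
    (t.1 ≠ t.2.1 ∧ t.2.1 ≠ t.2.2 ∧ t.1 ≠ t.2.2) ∧ cornerCode t.1 t.2.1 t.2.2 = n

/-- The pair with a given code. -/
def pairClass (n : ℕ) : Finset (Fin 6) :=
  Finset.univ.filter fun x => ∃ y, x ≠ y ∧ pairCode x y = n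

lemma cycClass_eq {x y z : Fin 6} (hxy : x ≠ y) (hyz : y ≠ z) (hxz : x ≠ z) :
    cycClass (x, y, z) = cornerClass (cornerCode x y z) := by
  ext ⟨a, b, c⟩
  simp only [cornerClass, Finset.mem_filter, Finset.mem_univ, true_and]
  refine ⟨fun h => ?_, fun h => cornerCode_eq h.2⟩
  simp only [cycClass, cyc, Finset.mem_insert, Finset.mem_singleton, Prod.mk.injEq] at h
  rcases h with ⟨rfl, rfl, rfl⟩ | ⟨rfl, rfl, rfl⟩ | ⟨rfl, rfl, rfl⟩
  · exact ⟨⟨hxy, hyz, hxz⟩, rfl⟩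
  · exact ⟨⟨hyz, hxz.symm, hxy.symm⟩, cornerCode_cyc _ _ _⟩
  · exact ⟨⟨hxz.symm, hxy, hyz.symm⟩, (cornerCode_cyc _ _ _).symm⟩

lemma pairClass_pairCode {x y : Fin 6} (hxy : x ≠ y) : pairClass (pairCode x y) = {x, y} := by
  ext a
  simp only [pairClass, Finset.mem_filter, Finset.mem_univ, true_and, Finset.mem_insert,
    Finset.mem_singleton]
  constructor
  · rintro ⟨b, hab, h⟩
    rcases pairCode_eq x y hxy a b hab h with h | h
    exacts [.inl h.1, .inr h.1]
  · rintro (rfl | rfl)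
    exacts [⟨y, hxy, rfl⟩, ⟨x, hxy.symm, pairCode_comm _ _⟩]

/-- One oriented triple of faces for each corner. -/
def cornerFaces : Finset (Fin 6 × Fin 6 × Fin 6) :=
  {(0, 1, 2), (0, 2, 4), (0, 4, 5), (0, 5, 1), (1, 3, 2), (3, 4, 2), (3, 1, 5), (3, 5, 4)}

/-- The action of a permutation on triples. -/
def mapTriple (g : Equiv.Perm (Fin 6)) (t : Fin 6 × Fin 6 × Fin 6) : Fin 6 × Fin 6 × Fin 6 :=
  (g t.1, g t.2.1, g t.2.2)

lemma mapTriple_mem_iff {g : Equiv.Perm (Fin 6)} (hg : g ∈ G) :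
    ∀ t, t ∈ cornerFaces.biUnion cycClass ↔ mapTriple g t ∈ cornerFaces.biUnion cycClass := by
  induction hg using Subgroup.closure_induction with
  | mem g hg =>
    rcases hg with rfl | rfl
    · decide +kernel
    · decide +kernel
  | one => exact fun t => Iff.rfl
  | mul g h _ _ ihg ihh => exact fun t => (ihh t).trans (ihg _)
  | inv g _ ih =>
    intro t
    rw [ih (mapTriple g⁻¹ t)]
    simp [mapTriple]

lemma exists_cornerFaces {g : Equiv.Perm (Fin 6)} (hg : g ∈ G) :
    ∃ p ∈ cornerFaces, (g 0, g 1, g 2) ∈ cycClass p :=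
  Finset.mem_biUnion.1 <| (mapTriple_mem_iff hg (0, 1, 2)).1 (by decide)

lemma exists_rotation : ∀ p ∈ cornerFaces, ∃ g ∈ G, (g 0, g 1, g 2) = p := by
  have h1 : r1 ∈ G := Subgroup.subset_closure (by simp)
  have h2 : r2 ∈ G := Subgroup.subset_closure (by simp)
  intro p hp
  simp only [cornerFaces, Finset.mem_insert, Finset.mem_singleton] at hp
  rcases hp with rfl | rfl | rfl | rfl | rfl | rfl | rfl | rfl
  · exact ⟨1, G.one_mem, rfl⟩
  · exact ⟨r2, h2, by decide +kernel⟩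
  · exact ⟨r2 ^ 2, G.pow_mem h2 2, by decide +kernel⟩
  · exact ⟨r2 ^ 3, G.pow_mem h2 3, by decide +kernel⟩
  · exact ⟨r1, h1, by decide +kernel⟩
  · exact ⟨r1 ^ 2, G.pow_mem h1 2, by decide +kernel⟩
  · exact ⟨r1 ^ 2 * r2 ^ 2, G.mul_mem (G.pow_mem h1 2) (G.pow_mem h2 2), by decide +kernel⟩
  · exact ⟨r1 ^ 2 * r2 ^ 3, G.mul_mem (G.pow_mem h1 2) (G.pow_mem h2 3), by decide +kernel⟩

lemma ne_of_mem_cornerFaces : ∀ p ∈ cornerFaces, p.1 ≠ p.2.1 ∧ p.2.1 ≠ p.2.2 ∧ p.1 ≠ p.2.2 := by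
  decide

lemma cycClass_mapTriple (c : CCube) {p q : Fin 6 × Fin 6 × Fin 6} (h : q ∈ cycClass p) :
    cycClass (mapTriple c q) = cycClass (mapTriple c p) := by
  simp only [cycClass, Finset.mem_insert, Finset.mem_singleton] at h
  ext t
  rcases h with rfl | rfl | rfl <;>
    simp only [cycClass, cyc, mapTriple, Finset.mem_insert, Finset.mem_singleton] <;> tauto

lemma cornerTriples_eq_image_cycClass (c : CCube) :
    cornerTriples c = cornerFaces.image fun p => cycClass (mapTriple c p) := by
  ext s
  simp only [cornerTriples, Finset.mem_filter, Finset.mem_univ, true_and, Finset.mem_image]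
  constructor
  · rintro ⟨g, hg, rfl⟩
    obtain ⟨p, hp, h⟩ := exists_cornerFaces hg
    exact ⟨p, hp, (cycClass_mapTriple c h).symm⟩
  · rintro ⟨p, hp, rfl⟩
    obtain ⟨g, hg, rfl⟩ := exists_rotation p hp
    exact ⟨g, hg, rfl⟩

lemma bits_cornerMask (c : CCube) : bits 144 (cornerMask c) =
    cornerFaces.image fun p => cornerCode (c p.1) (c p.2.1) (c p.2.2) := by
  have hlt : ∀ p ∈ cornerFaces, cornerCode (c p.1) (c p.2.1) (c p.2.2) < 144 := fun p hp =>
    have h := ne_of_mem_cornerFaces p hp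
    cornerCode_lt _ _ _ (c.injective.ne h.1) (c.injective.ne h.2.1) (c.injective.ne h.2.2)
  ext i
  rw [mem_bits, Finset.mem_image]
  have hbit : (cornerMask c).testBit i ↔
      ∃ p ∈ cornerFaces, cornerCode (c p.1) (c p.2.1) (c p.2.2) = i := by
    simp [cornerMask, cornerFaces, Nat.testBit_or, Nat.testBit_two_pow, or_assoc]
  rw [hbit]
  exact ⟨fun h => h.2, fun ⟨p, hp, h⟩ => ⟨h ▸ hlt p hp, p, hp, h⟩⟩

lemma cornerTriples_eq (c : CCube) :
    cornerTriples c = (bits 144 (cornerMask c)).image cornerClass := by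
  rw [cornerTriples_eq_image_cycClass, bits_cornerMask, Finset.image_image]
  refine Finset.image_congr fun p hp => ?_
  have h := ne_of_mem_cornerFaces p hp
  exact cycClass_eq (c.injective.ne h.1) (c.injective.ne h.2.1) (c.injective.ne h.2.2)

lemma card_cornerTriples_eq (c : CCube) :
    (cornerTriples c).card = (bits 144 (cornerMask c)).card := by
  rw [cornerTriples_eq, Finset.card_image_of_injOn]
  intro i hi j _ hij
  rw [bits_cornerMask, Finset.mem_coe, Finset.mem_image] at hi
  obtain ⟨p, hp, rfl⟩ := hi
  have h := ne_of_mem_cornerFaces p hp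
  have hmem : (c p.1, c p.2.1, c p.2.2) ∈
      cornerClass (cornerCode (c p.1) (c p.2.1) (c p.2.2)) := by
    simp [cornerClass, h]
  rw [hij] at hmem
  exact (Finset.mem_filter.1 hmem).2.2

lemma ne_tau : ∀ a, a ≠ tau a := by decide

lemma tau_tau : ∀ a, tau (tau a) = a := by decide

lemma mem_bits_oppMask {c : CCube} {i : ℕ} :
    i ∈ bits 36 (oppMask c) ↔ ∃ a, pairCode (c a) (c (tau a)) = i := by
  have hbit : (oppMask c).testBit i ↔ pairCode (c 0) (c 3) = i ∨ pairCode (c 1) (c 4) = i ∨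
      pairCode (c 2) (c 5) = i := by
    simp [oppMask, Nat.testBit_or, Nat.testBit_two_pow, or_assoc]
  rw [mem_bits, hbit]
  constructor
  · rintro ⟨-, h | h | h⟩
    exacts [⟨0, h⟩, ⟨1, h⟩, ⟨2, h⟩]
  · rintro ⟨a, rfl⟩
    refine ⟨(pairCode_mem_fullPair _ _ (c.injective.ne ?_)).1, ?_⟩
    · exact ne_tau a
    · fin_cases a
      exacts [.inl rfl, .inr (.inl rfl), .inr (.inr rfl), .inl (pairCode_comm _ _),
        .inr (.inl (pairCode_comm _ _)), .inr (.inr (pairCode_comm _ _))]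

lemma adjPairs_eq (c : CCube) :
    adjPairs c = (bits 36 fullPair \ bits 36 (oppMask c)).image pairClass := by
  ext s
  simp only [adjPairs, Finset.mem_image, Finset.mem_filter, Finset.mem_univ, true_and,
    Finset.mem_sdiff, mem_bits_oppMask, mem_bits (m := fullPair), Prod.exists]
  constructor
  · rintro ⟨i, j, ⟨hne, hopp⟩, rfl⟩
    have hc : c i ≠ c j := c.injective.ne hne.symm
    refine ⟨pairCode (c i) (c j), ⟨pairCode_mem_fullPair _ _ hc, ?_⟩, pairClass_pairCode hc⟩
    rintro ⟨a, ha⟩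
    rcases pairCode_eq _ _ hc _ _ (c.injective.ne (ne_tau a)) ha with ⟨h, h'⟩ | ⟨h, h'⟩
    · exact hopp (by rw [← c.injective h, ← c.injective h'])
    · refine hopp ?_
      rw [← c.injective h, ← c.injective h']
      exact (tau_tau a).symm
  · rintro ⟨n, ⟨⟨hn, hfull⟩, hopp⟩, rfl⟩
    obtain ⟨x, y, hxy, rfl⟩ := testBit_fullPair n hn hfull
    refine ⟨c.symm x, c.symm y, ⟨c.symm.injective.ne hxy.symm, fun h => hopp ⟨c.symm x, ?_⟩⟩, ?_⟩
    · rw [← h, c.apply_symm_apply, c.apply_symm_apply]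
    · rw [c.apply_symm_apply, c.apply_symm_apply, pairClass_pairCode hxy]

lemma card_adjPairs_eq (c : CCube) :
    (adjPairs c).card = (bits 36 fullPair \ bits 36 (oppMask c)).card := by
  rw [adjPairs_eq, Finset.card_image_of_injOn]
  intro i hi j hj hij
  simp only [Finset.coe_sdiff, Set.mem_sdiff, Finset.mem_coe, mem_bits (m := fullPair)] at hi hj
  obtain ⟨x, y, hxy, rfl⟩ := testBit_fullPair i hi.1.1 hi.1.2
  obtain ⟨a, b, hab, rfl⟩ := testBit_fullPair j hj.1.1 hj.1.2
  have ha : a ∈ pairClass (pairCode a b) := by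
    simpa [pairClass] using ⟨b, hab, rfl⟩
  rw [← hij] at ha
  have hb : b ∈ pairClass (pairCode a b) := by
    simpa [pairClass] using ⟨a, hab.symm, pairCode_comm _ _⟩
  rw [← hij] at hb
  rw [pairClass_pairCode hxy, Finset.mem_insert, Finset.mem_singleton] at ha hb
  rcases ha with rfl | rfl <;> rcases hb with rfl | rfl
  · exact absurd rfl hab
  · rfl
  · exact pairCode_comm _ _
  · exact absurd rfl hab

lemma exists_variety (c : CCube) : ∃ v, cornerMask c = repCorner v ∧ oppMask c = repOpp v := by
  have hc : ∀ {i j}, i ≠ j → c i ≠ c j := fun h => c.injective.ne h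
  obtain ⟨v, h, h'⟩ := exists_rep (c 0) (c 1) (hc (by decide)) (c 2)
    ⟨hc (by decide), hc (by decide)⟩ (c 3) ⟨hc (by decide), hc (by decide), hc (by decide)⟩ (c 4)
    ⟨hc (by decide), hc (by decide), hc (by decide), hc (by decide)⟩ (c 5)
    ⟨hc (by decide), hc (by decide), hc (by decide), hc (by decide), hc (by decide)⟩
  have heq : ![c 0, c 1, c 2, c 3, c 4, c 5] = c := by
    funext i
    fin_cases i <;> rfl
  exact ⟨v, heq ▸ h', heq ▸ h⟩

/-- The index of the variety of a colored cube. -/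
noncomputable def varietyIndex (c : CCube) : Fin 30 := (exists_variety c).choose

lemma cornerTriples_eq_corners (c : CCube) :
    cornerTriples c = (corners (varietyIndex c)).image cornerClass := by
  rw [cornerTriples_eq, (exists_variety c).choose_spec.1]
  rfl

lemma adjPairs_eq_opps (c : CCube) :
    adjPairs c = (bits 36 fullPair \ opps (varietyIndex c)).image pairClass := by
  rw [adjPairs_eq, (exists_variety c).choose_spec.2]
  rfl

lemma card_cornerTriples (c : CCube) : (cornerTriples c).card = 8 := by
  rw [card_cornerTriples_eq, (exists_variety c).choose_spec.1, card_bits, popCount_repCorner]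

lemma card_adjPairs (c : CCube) : (adjPairs c).card = 12 := by
  rw [card_adjPairs_eq, (exists_variety c).choose_spec.2]
  exact card_sdiff_opps _

lemma exists_cube (v : Fin 30) : ∃ m : CCube, cornerTriples m = (corners v).image cornerClass ∧
    adjPairs m = (bits 36 fullPair \ opps v).image pairClass := by
  have hm : ⇑(Equiv.ofBijective (rep v) (Finite.injective_iff_bijective.1 (rep_injective v))) =
    rep v := rfl
  refine ⟨Equiv.ofBijective (rep v) (Finite.injective_iff_bijective.1 (rep_injective v)), ?_, ?_⟩
  · rw [cornerTriples_eq, hm, cornerMask_rep]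
    rfl
  · rw [adjPairs_eq, hm, oppMask_rep]
    rfl

lemma card_filter_varietyIndex {ι : Type*} [Fintype ι] (q : ι → CCube) (p : Fin 30 → Prop)
    [DecidablePred p] :
    ∑ u with p u, (Finset.univ.filter fun i => varietyIndex (q i) = u).card =
      (Finset.univ.filter fun i => p (varietyIndex (q i))).card := by
  rw [Finset.card_eq_sum_card_fiberwise (f := fun i => varietyIndex (q i))
    (t := Finset.univ.filter p) (fun i hi => by simpa using hi)]
  refine Finset.sum_congr rfl fun u hu => ?_
  rw [Finset.filter_filter]
  congr 1
  ext i
  have := (Finset.mem_filter.1 hu).2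
  simp only [Finset.mem_filter, Finset.mem_univ, true_and]
  exact ⟨fun h => ⟨h ▸ this, h⟩, fun h => h.2⟩

/-- Hall's condition for the frame of some variety, in terms of colored cubes. -/
lemma exists_cube_hall {ι : Type*} [Fintype ι] {k : ℕ} (hk : 2 ≤ k) (q : ι → CCube)
    (hι : Fintype.card ι = 12 * k + 8) :
    ∃ m : CCube, ∀ T ⊆ cornerTriples m, ∀ E ⊆ adjPairs m, ∃ s : Finset ι,
      T.card + k * E.card ≤ s.card ∧
        ∀ i ∈ s, (∃ t ∈ T, t ∈ cornerTriples (q i)) ∨ ∃ e ∈ E, e ∈ adjPairs (q i) := by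
  obtain ⟨v, hv⟩ := exists_frameHallAt_corners hk
    (x := fun u => (Finset.univ.filter fun i => varietyIndex (q i) = u).card) (by
      rw [← hι, ← Finset.card_univ]
      exact (Finset.card_eq_sum_card_fiberwise fun i _ => Finset.mem_coe.2 (Finset.mem_univ _)).symm)
  obtain ⟨m, hm, hm'⟩ := exists_cube v
  refine ⟨m, fun T hT E hE => ?_⟩
  rw [hm] at hT
  rw [hm'] at hE
  obtain ⟨T, hT', rfl⟩ := Finset.subset_image_iff.1 hT
  obtain ⟨E, hE', rfl⟩ := Finset.subset_image_iff.1 hE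
  have hTE : T.card + k * E.card ≤ ∑ u with ¬Disjoint (corners u) T ∨ ¬E ⊆ opps u,
      (Finset.univ.filter fun i => varietyIndex (q i) = u).card :=
    hv T (by exact_mod_cast hT') E (by exact_mod_cast hE')
  rw [card_filter_varietyIndex] at hTE
  refine ⟨_, (Nat.add_le_add Finset.card_image_le
    (Nat.mul_le_mul_left k Finset.card_image_le)).trans hTE, fun i hi => ?_⟩
  refine (Finset.mem_filter.1 hi).2.imp (fun h => ?_) fun h => ?_
  · obtain ⟨s, hs, hsT⟩ := Finset.not_disjoint_iff.1 h
    refine ⟨_, Finset.mem_image_of_mem _ hsT, ?_⟩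
    rw [cornerTriples_eq_corners]
    exact Finset.mem_image_of_mem _ hs
  · obtain ⟨e, he, he'⟩ := Finset.not_subset.1 h
    refine ⟨_, Finset.mem_image_of_mem _ he, ?_⟩
    rw [adjPairs_eq_opps]
    have heD : e ∈ bits 36 fullPair \ opps v := by exact_mod_cast hE' he
    exact Finset.mem_image_of_mem _
      (Finset.mem_sdiff.2 ⟨(Finset.mem_sdiff.1 heD).1, he'⟩)

lemma map_val_eq_sum {ι γ : Type*} (C : Finset γ) (u : γ → ι) : C.val.map u = ∑ c ∈ C, {u c} := by
  rw [← Multiset.sum_map_singleton (C.val.map u), Multiset.map_map]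
  rfl

section Slots

variable {ι α β : Type*} [Fintype ι] {A : Finset α} {B : Finset β} {R : ι → Finset α}
  {Q : ι → Finset β} {k : ℕ}

lemma exists_injective_slots (h : ∀ T ⊆ A, ∀ E ⊆ B, ∃ s : Finset ι,
      T.card + k * E.card ≤ s.card ∧ ∀ i ∈ s, (∃ t ∈ T, t ∈ R i) ∨ ∃ e ∈ E, e ∈ Q i) :
    ∃ f : A ⊕ B × Fin k → ι, Function.Injective f ∧ (∀ t, t.1 ∈ R (f (.inl t))) ∧
      ∀ p, p.1.1 ∈ Q (f (.inr p)) := by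
  let F : A ⊕ B × Fin k → Finset ι :=
    Sum.elim (fun t => Finset.univ.filter fun i => t.1 ∈ R i)
      (fun p => Finset.univ.filter fun i => p.1.1 ∈ Q i)
  obtain ⟨f, hf, hfF⟩ := (Finset.all_card_le_biUnion_card_iff_exists_injective F).1 fun Y => by
    have hY : Y ⊆ Y.toLeft.disjSum (Y.toRight.image Prod.fst ×ˢ Finset.univ) := by
      rintro (t | p) h
      · simpa using h
      · simpa using ⟨p.2, h⟩
    have hA : Y.toLeft.image Subtype.val ⊆ A := fun t ht => by
      obtain ⟨t, -, rfl⟩ := Finset.mem_image.1 ht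
      exact t.2
    have hB : (Y.toRight.image Prod.fst).image Subtype.val ⊆ B := fun e he => by
      obtain ⟨e, -, rfl⟩ := Finset.mem_image.1 he
      exact e.2
    obtain ⟨s, hcard, hs⟩ := h _ hA _ hB
    rw [Finset.card_image_of_injective _ Subtype.val_injective,
      Finset.card_image_of_injective _ Subtype.val_injective] at hcard
    have hY' := Finset.card_le_card hY
    rw [Finset.card_disjSum, Finset.card_product, Finset.card_univ, Fintype.card_fin,
      mul_comm] at hY'
    refine hY'.trans (hcard.trans (Finset.card_le_card fun i hi => ?_))
    rw [Finset.mem_biUnion]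
    obtain ⟨t, ht, hti⟩ | ⟨e, he, hei⟩ := hs i hi
    · obtain ⟨t, htY, rfl⟩ := Finset.mem_image.1 ht
      exact ⟨.inl t, Finset.mem_toLeft.1 htY, Finset.mem_filter.2 ⟨Finset.mem_univ _, hti⟩⟩
    · obtain ⟨e, heY, rfl⟩ := Finset.mem_image.1 he
      obtain ⟨p, hp, rfl⟩ := Finset.mem_image.1 heY
      exact ⟨.inr p, Finset.mem_toRight.1 hp, Finset.mem_filter.2 ⟨Finset.mem_univ _, hei⟩⟩
  exact ⟨f, hf, fun t => (Finset.mem_filter.1 (hfF (.inl t))).2,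
    fun p => (Finset.mem_filter.1 (hfF (.inr p))).2⟩

lemma exists_slots [Nonempty ι] (h : ∀ T ⊆ A, ∀ E ⊆ B, ∃ s : Finset ι,
      T.card + k * E.card ≤ s.card ∧ ∀ i ∈ s, (∃ t ∈ T, t ∈ R i) ∨ ∃ e ∈ E, e ∈ Q i) :
    ∃ (g : α → ι) (e : β → Fin k → ι), (∀ t ∈ A, t ∈ R (g t)) ∧ (∀ p ∈ B, ∀ j, p ∈ Q (e p j)) ∧
      A.val.map g + ∑ p ∈ B, Finset.univ.val.map (e p) ≤ Finset.univ.val := by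
  obtain ⟨f, hf, hA, hB⟩ := exists_injective_slots h
  let g : α → ι := fun t => if h : t ∈ A then f (.inl ⟨t, h⟩) else Classical.arbitrary ι
  let e : β → Fin k → ι := fun p j =>
    if h : p ∈ B then f (.inr (⟨p, h⟩, j)) else Classical.arbitrary ι
  have hg : ∀ t : A, g t = f (.inl t) := fun t => dif_pos t.2
  have he : ∀ (p : B) j, e p j = f (.inr (p, j)) := fun p j => dif_pos p.2
  refine ⟨g, e, fun t ht => hg ⟨t, ht⟩ ▸ hA ⟨t, ht⟩,
    fun p hp j => he ⟨p, hp⟩ j ▸ hB (⟨p, hp⟩, j), ?_⟩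
  have key : A.val.map g + ∑ p ∈ B, Finset.univ.val.map (e p) = Finset.univ.val.map f := by
    rw [map_val_eq_sum, map_val_eq_sum, Fintype.sum_sum_type, Fintype.sum_prod_type,
      ← Finset.sum_coe_sort A, ← Finset.sum_coe_sort B]
    simp only [map_val_eq_sum, hg, he]
  rw [key]
  exact (Multiset.le_iff_subset (Finset.univ.nodup.map hf)).2 fun i _ => Finset.mem_univ i

lemma exists_frame {γ : Type*} {R' : γ → Finset α} {Q' : γ → Finset β} {l : List γ} (hl : l ≠ [])
    (h : ∀ T ⊆ A, ∀ E ⊆ B, ∃ s : Finset (Fin l.length), T.card + k * E.card ≤ s.card ∧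
      ∀ i ∈ s, (∃ t ∈ T, t ∈ R' (l.get i)) ∨ ∃ e ∈ E, e ∈ Q' (l.get i)) :
    ∃ (ψ : α → γ) (f : β → Multiset γ), (∀ t ∈ A, t ∈ R' (ψ t)) ∧
      (∀ p ∈ B, Multiset.card (f p) = k ∧ ∀ x ∈ f p, p ∈ Q' x) ∧
      Multiset.map ψ A.val + B.sum f ≤ l := by
  have : Nonempty (Fin l.length) := ⟨⟨0, List.length_pos_iff.2 hl⟩⟩
  obtain ⟨g, e, hg, he, hle⟩ := exists_slots (R := fun i => R' (l.get i))
    (Q := fun i => Q' (l.get i)) h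
  refine ⟨fun t => l.get (g t), fun p => (Finset.univ.val.map (e p)).map l.get, hg,
    fun p hp => ⟨by simp, fun x hx => ?_⟩, ?_⟩
  · obtain ⟨i, hi, rfl⟩ := Multiset.mem_map.1 hx
    obtain ⟨j, -, rfl⟩ := Multiset.mem_map.1 hi
    exact he p hp j
  · have hl' : (Finset.univ.val.map l.get : Multiset γ) = l := by simp
    have hsum := map_sum (Multiset.mapAddMonoidHom l.get) (fun p => Finset.univ.val.map (e p)) B
    simp only [Multiset.coe_mapAddMonoidHom] at hsum
    have hmap := Multiset.map_le_map (f := l.get) hle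
    rwa [Multiset.map_add, Multiset.map_map, hsum, hl'] at hmap

lemma card_add_le_of_exists {γ : Type*} (A : Finset α) (B : Finset β) (R' : γ → Finset α)
    (Q' : γ → Finset β) (k : ℕ) (S : Multiset γ)
    (h : ∃ (ψ : α → γ) (f : β → Multiset γ), (∀ t ∈ A, t ∈ R' (ψ t)) ∧
      (∀ p ∈ B, Multiset.card (f p) = k ∧ ∀ x ∈ f p, p ∈ Q' x) ∧
      Multiset.map ψ A.val + B.sum f ≤ S) :
    A.card + B.card * k ≤ Multiset.card S := by
  obtain ⟨ψ, f, -, hf, hle⟩ := h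
  have hcard := Multiset.card_le_card hle
  rwa [Multiset.card_add, Multiset.card_map, Finset.card_val, Multiset.card_sum,
    Finset.sum_congr rfl fun p hp => (hf p hp).1, Finset.sum_const, smul_eq_mul] at hcard

end Slots

lemma hasFrameSolution {n : ℕ} (hn : 4 ≤ n) {S : Multiset CCube}
    (hS : Multiset.card S = 12 * n - 16) : HasFrameSolution n S := by
  induction S using Quotient.inductionOn with | _ l
  have hl : l.length = 12 * (n - 2) + 8 := hS.trans (by omega)
  obtain ⟨m, hm⟩ := exists_cube_hall (k := n - 2) (by omega) l.get (by rw [Fintype.card_fin, hl])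
  exact ⟨m, exists_frame (A := cornerTriples m) (B := adjPairs m) (R' := cornerTriples)
    (Q' := adjPairs) (List.length_pos_iff.1 (by omega)) hm⟩

/-- For `n ≥ 4`, every multiset of exactly `12n - 16` colored cubes admits an `n`-frame
solution (necessarily using all of its cubes), so the least number of colored cubes
guaranteeing an `n`-frame equals `12n - 16`. -/
theorem fr_n (n : ℕ) (hn : 4 ≤ n) :
    (∀ S : Multiset CCube, Multiset.card S = 12 * n - 16 → HasFrameSolution n S) ∧
    IsLeast {N : ℕ | ∀ S : Multiset CCube, Multiset.card S = N → HasFrameSolution n S}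
      (12 * n - 16) := by
  refine ⟨fun S => hasFrameSolution hn, fun S => hasFrameSolution hn, fun N hN => ?_⟩
  obtain ⟨m, hm⟩ := hN (Multiset.replicate N 1) (Multiset.card_replicate N 1)
  have hcard := card_add_le_of_exists (cornerTriples m) (adjPairs m) cornerTriples adjPairs (n - 2)
    (Multiset.replicate N 1) hm
  rw [card_cornerTriples, card_adjPairs, Multiset.card_replicate] at hcard
  omega
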